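/- Let u, v ∈ W^P. Then the following conditions are equivalent: (i) u ≤ v in the Bruhat order; (ii) Φ⁺(u) ⊆ Φ⁺(v); (iii) v(ω_P^∨) ≤ u(ω_P^∨) in the dominance order on coweights; (iv) v(ω_P) ≤ u(ω_P) in the dominance order on weights. -/

import Mathlib

open scoped RealInnerProductSpace
open Classical

noncomputable section

variable (V : Type) [NormedAddCommGroup V] [InnerProductSpace ℝ V]

/-- The reflection determined by a vector `α` (the identity map if `α = 0`),
as a linear endomorphism:  `x ↦ x - (2⟪x,α⟫/⟪α,α⟫) • α`. -/
def reflMap (α : V) : V →ₗ[ℝ] V where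
  toFun x := x - (2 * ⟪x, α⟫ / ⟪α, α⟫) • α
  map_add' x y := by
    simp only [inner_add_left]
    rw [show 2 * (⟪x, α⟫ + ⟪y, α⟫) / ⟪α, α⟫
        = 2 * ⟪x, α⟫ / ⟪α, α⟫ + 2 * ⟪y, α⟫ / ⟪α, α⟫ by ring, add_smul]
    abel
  map_smul' c x := by
    simp only [real_inner_smul_left, RingHom.id_apply, smul_sub]
    rw [show 2 * (c * ⟪x, α⟫) / ⟪α, α⟫ = c * (2 * ⟪x, α⟫ / ⟪α, α⟫) by ring,
      mul_smul]

lemma reflMap_apply (α x : V) :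
    reflMap V α x = x - (2 * ⟪x, α⟫ / ⟪α, α⟫) • α := rfl

lemma reflMap_involutive (α : V) : ∀ x, reflMap V α (reflMap V α x) = x := by
  intro x
  by_cases h : (⟪α, α⟫ : ℝ) = 0
  · have h0 : α = 0 := inner_self_eq_zero.mp h
    simp [reflMap_apply, h0]
  · rw [reflMap_apply, reflMap_apply, inner_sub_left, real_inner_smul_left,
      div_mul_cancel₀ _ h]
    rw [show ⟪x, α⟫ - 2 * ⟪x, α⟫ = -⟪x, α⟫ by ring]
    rw [show 2 * -⟪x, α⟫ / ⟪α, α⟫ = -(2 * ⟪x, α⟫ / ⟪α, α⟫) by ring, neg_smul]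
    abel

/-- The reflection determined by a vector `α`, as a linear automorphism of `V`. -/
def sref (α : V) : V ≃ₗ[ℝ] V :=
  { reflMap V α with
    invFun := reflMap V α
    left_inv := reflMap_involutive V α
    right_inv := reflMap_involutive V α }

lemma sref_apply (α x : V) :
    sref V α x = x - (2 * ⟪x, α⟫ / ⟪α, α⟫) • α := rfl

variable {V}

/-- The coroot `α^∨ = 2α/⟪α,α⟫` associated with a root `α`, under the identification of the
coweight space with `V` given by the inner product. -/
def coroot (α : V) : V := (2 / ⟪α, α⟫) • α

/-- The dimension of the `(-1)`-eigenspace of a linear automorphism. -/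
def lamEig (σ : V ≃ₗ[ℝ] V) : ℕ :=
  Module.finrank ℝ (Module.End.eigenspace (σ : V →ₗ[ℝ] V) (-1))

/-- The action `s_α ∘ σ` of a simple reflection on an involution: `s_α σ` if `s_α` and `σ`
commute, and `s_α σ s_α` otherwise. -/
def circAct (α : V) (σ : V ≃ₗ[ℝ] V) : V ≃ₗ[ℝ] V :=
  if sref V α * σ = σ * sref V α then sref V α * σ else sref V α * σ * sref V α

/-- A set of pairwise orthogonal vectors. -/
def OrthSet (S : Finset V) : Prop :=
  (↑S : Set V).Pairwise fun a b => ⟪a, b⟫ = 0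

/-- The product `σ_S` of the (commuting) reflections in the elements of an orthogonal set
`S`. -/
def sigmaOf (S : Finset V) : V ≃ₗ[ℝ] V :=
  (S.toList.map (sref V)).prod

variable (V)

/-- A finite crystallographic reduced root system in the Euclidean space `V`,
together with a fixed choice of simple roots. -/
structure RSD where
  /-- The set of roots. -/
  Φ : Finset V
  /-- The set of simple roots. -/
  Δ : Finset V
  nonzero : (0 : V) ∉ Φ
  span_top : Submodule.span ℝ (Φ : Set V) = ⊤
  reduced : ∀ α ∈ Φ, ∀ c : ℝ, c • α ∈ Φ → c = 1 ∨ c = -1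
  crystal : ∀ α ∈ Φ, ∀ β ∈ Φ, ∃ n : ℤ, (n : ℝ) = 2 * ⟪β, α⟫ / ⟪α, α⟫
  reflClosed : ∀ α ∈ Φ, ∀ β ∈ Φ, sref V α β ∈ Φ
  Δ_sub : Δ ⊆ Φ
  Δ_indep : LinearIndependent ℝ (fun x : (Δ : Set V) => (x : V))
  Δ_base : ∀ α ∈ Φ, (∃ c : V → ℕ, α = ∑ γ ∈ Δ, (c γ : ℝ) • γ) ∨
      (∃ c : V → ℕ, -α = ∑ γ ∈ Δ, (c γ : ℝ) • γ)

namespace RSD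

variable {V}
variable (D : RSD V)

/-- The set of positive roots. -/
def Pos : Set V :=
  {α | α ∈ D.Φ ∧ ∃ c : V → ℕ, α = ∑ γ ∈ D.Δ, (c γ : ℝ) • γ}

/-- The set of negative roots. -/
def Neg : Set V := {α | -α ∈ D.Pos}

/-- The Weyl group, as the subgroup of `GL(V)` generated by the simple reflections. -/
def W : Subgroup (V ≃ₗ[ℝ] V) := Subgroup.closure ((fun γ => sref V γ) '' ↑D.Δ)

/-- The length of `w`: the least number of simple reflections needed to write `w` as a
product of simple reflections. -/
def length (w : V ≃ₗ[ℝ] V) : ℕ :=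
  sInf {n | ∃ l : List V, l.length = n ∧ (∀ γ ∈ l, γ ∈ D.Δ) ∧ w = (l.map (sref V)).prod}

/-- The Bruhat order on the Weyl group: `u ≤ v` iff `v` is obtained from `u` by successively
multiplying by reflections, each time increasing the length. -/
def ble (u v : V ≃ₗ[ℝ] V) : Prop :=
  Relation.ReflTransGen
    (fun x y => (∃ β ∈ D.Φ, y = sref V β * x) ∧ D.length x < D.length y) u v

/-- The strict Bruhat order. -/
def blt (u v : V ≃ₗ[ℝ] V) : Prop := D.ble u v ∧ u ≠ v

/-- The dominance order: `y - x` is a nonnegative integer combination of simple roots. -/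
def dom (x y : V) : Prop := ∃ c : V → ℕ, y - x = ∑ γ ∈ D.Δ, (c γ : ℝ) • γ

/-- The dominance order on coweights: `y - x` is a nonnegative integer combination of simple
coroots. -/
def cdom (x y : V) : Prop := ∃ c : V → ℕ, y - x = ∑ γ ∈ D.Δ, (c γ : ℝ) • coroot γ

/-- The length `L(σ) = (ℓ(σ) + λ(σ))/2` of an involution `σ`, where `λ(σ)` is the dimension
of the `(-1)`-eigenspace of `σ`. -/
def Linv (σ : V ≃ₗ[ℝ] V) : ℚ :=
  ((D.length σ : ℚ) + (lamEig σ : ℚ)) / 2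

end RSD

/-- A finite irreducible crystallographic reduced root system, with a fixed choice of simple
roots and a marked simple root `αP` whose coefficient in the highest root `θ` equals `1`
(the cominuscule case). -/
structure MRSD extends RSD V where
  irred : ¬ ∃ A B : Set V, A.Nonempty ∧ B.Nonempty ∧ A ∪ B = ↑Φ ∧
      ∀ α ∈ A, ∀ β ∈ B, ⟪α, β⟫ = 0
  /-- The marked simple root. -/
  αP : V
  αP_mem : αP ∈ Δ
  /-- The highest root. -/
  θ : V
  θ_mem : θ ∈ Φ
  θ_high : ∀ α ∈ Φ, ∃ c : V → ℕ, θ - α = ∑ γ ∈ Δ, (c γ : ℝ) • γ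
  θ_coeff : ∃ c : V → ℕ, (θ = ∑ γ ∈ Δ, (c γ : ℝ) • γ) ∧ c αP = 1

namespace MRSD

variable {V}
variable (M : MRSD V)

/-- The set `Ψ` of positive roots in which the marked simple root `αP` has coefficient `1`. -/
def Psi : Set V :=
  {α | α ∈ M.Φ ∧ ∃ c : V → ℕ, (α = ∑ γ ∈ M.Δ, (c γ : ℝ) • γ) ∧ c M.αP = 1}

/-- The set of positive roots of the subsystem `Φ_P`, i.e. the positive roots in which the
marked simple root `αP` has coefficient `0`. -/
def PosP : Set V :=
  {α | α ∈ M.Φ ∧ ∃ c : V → ℕ, (α = ∑ γ ∈ M.Δ, (c γ : ℝ) • γ) ∧ c M.αP = 0}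

/-- The parabolic subgroup `W_P` generated by the simple reflections in `Δ ∖ {αP}`. -/
def WP : Subgroup (V ≃ₗ[ℝ] V) :=
  Subgroup.closure ((fun γ => sref V γ) '' ↑(M.Δ.erase M.αP))

/-- The inversion set `Φ⁺(v) = {α ∈ Φ⁺ : v(α) ∈ Φ⁻}`. -/
def InvSet (v : V ≃ₗ[ℝ] V) : Set V := {α | α ∈ M.Pos ∧ v α ∈ M.Neg}

/-- `v` belongs to `W^P`: it lies in `W` and has minimal length in its coset `v W_P`. -/
def IsMinRep (v : V ≃ₗ[ℝ] V) : Prop :=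
  v ∈ M.W ∧ ∀ u, u ∈ M.W → v⁻¹ * u ∈ M.WP → M.length v ≤ M.length u

/-- `μ` is the minimal length representative `[w]^P` of the coset `w W_P`. -/
def IsMinRepOf (μ w : V ≃ₗ[ℝ] V) : Prop :=
  (μ ∈ M.W ∧ w⁻¹ * μ ∈ M.WP) ∧
    ∀ u, u ∈ M.W → w⁻¹ * u ∈ M.WP → M.length μ ≤ M.length u

/-- The subset `Φ_S = {α ∈ Φ : σ_S(α) = -α}` determined by an orthogonal set of roots `S`. -/
def PhiSet (S : Finset V) : Set V := {α | α ∈ M.Φ ∧ sigmaOf S α = -α}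

/-- A root is long if its squared length is maximal among the roots. -/
def IsLong (α : V) : Prop := ∀ β ∈ M.Φ, ⟪β, β⟫ ≤ ⟪α, α⟫

/-- Admissible pair: `v ∈ W^P`, `S ⊆ Ψ` a set of pairwise orthogonal roots with
`v(S) ⊆ Φ⁻`. -/
def Admissible (v : V ≃ₗ[ℝ] V) (S : Finset V) : Prop :=
  M.IsMinRep v ∧ (↑S : Set V) ⊆ M.Psi ∧ OrthSet S ∧ ∀ β ∈ S, v β ∈ M.Neg

/-- The length `L(v,S) = (ℓ(σ_{v(S)}) + |S|)/2` of an admissible pair `(v,S)`. -/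
def pairL (v : V ≃ₗ[ℝ] V) (S : Finset V) : ℚ :=
  ((M.length (sigmaOf (S.image fun x => v x)) : ℚ) + (S.card : ℚ)) / 2

end MRSD

section

variable {V}

/-! ### Simple coordinates and positive roots -/

namespace RSD

variable (D : RSD V)

lemma ne_zero_of_mem {α : V} (h : α ∈ D.Φ) : α ≠ 0 := fun h0 => D.nonzero (h0 ▸ h)

lemma inner_self_pos {α : V} (h : α ∈ D.Φ) : 0 < ⟪α, α⟫ :=
  real_inner_self_pos.mpr (D.ne_zero_of_mem h)

/-- The simple roots, as a basis of `V`. -/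
def simpleBasis : Module.Basis (D.Δ : Set V) ℝ V :=
  Module.Basis.mk D.Δ_indep (by
    rw [← D.span_top, Submodule.span_le]
    intro α hα
    have key : ∀ c : V → ℕ, ∑ γ ∈ D.Δ, (c γ : ℝ) • γ ∈
        Submodule.span ℝ (Set.range fun x : (D.Δ : Set V) => (x : V)) := fun c =>
      Submodule.sum_mem _ fun γ hγ =>
        Submodule.smul_mem _ _ (Submodule.subset_span ⟨⟨γ, hγ⟩, rfl⟩)
    rcases D.Δ_base α hα with ⟨c, hc⟩ | ⟨c, hc⟩
    · exact hc ▸ key c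
    · exact neg_mem_iff.mp (hc ▸ key c))

/-- The coefficient of `γ` in the expansion of a vector in the simple roots. -/
def coef (γ : V) : V →ₗ[ℝ] ℝ :=
  if h : γ ∈ D.Δ then D.simpleBasis.coord ⟨γ, h⟩ else 0

lemma coef_simple {γ δ : V} (hγ : γ ∈ D.Δ) (hδ : δ ∈ D.Δ) :
    D.coef γ δ = if δ = γ then 1 else 0 := by
  have h : D.simpleBasis ⟨δ, hδ⟩ = δ := by simp [simpleBasis]
  rw [coef, dif_pos hγ, ← h, Module.Basis.coord_apply, Module.Basis.repr_self,
    Finsupp.single_apply, h]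
  simp [Subtype.ext_iff]

lemma coef_sum (c : V → ℝ) {γ : V} (hγ : γ ∈ D.Δ) :
    D.coef γ (∑ δ ∈ D.Δ, c δ • δ) = c γ := by
  rw [map_sum, Finset.sum_eq_single γ]
  · simp [D.coef_simple hγ hγ]
  · intro δ hδ hne
    simp [D.coef_simple hγ hδ, hne]
  · exact fun h => absurd hγ h

lemma sum_coef (x : V) : ∑ γ ∈ D.Δ, D.coef γ x • γ = x := by
  conv_rhs => rw [← D.simpleBasis.sum_repr x]
  rw [← Finset.sum_coe_sort]
  refine Finset.sum_congr rfl fun γ _ => ?_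
  rw [coef, dif_pos γ.2]
  simp [simpleBasis]

lemma neg_mem {α : V} (h : α ∈ D.Φ) : -α ∈ D.Φ := by
  have h1 := D.reflClosed α h α h
  rwa [sref_apply, mul_div_cancel_right₀ _ (D.inner_self_pos h).ne', two_smul,
    sub_add_cancel_left] at h1

lemma mem_Pos_iff {α : V} : α ∈ D.Pos ↔ α ∈ D.Φ ∧ ∀ γ ∈ D.Δ, 0 ≤ D.coef γ α := by
  constructor
  · rintro ⟨h, c, hc⟩
    refine ⟨h, fun γ hγ => ?_⟩
    rw [hc, D.coef_sum (fun δ => (c δ : ℝ)) hγ]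
    positivity
  · rintro ⟨h, h0⟩
    refine ⟨h, (D.Δ_base α h).resolve_right ?_⟩
    rintro ⟨c, hc⟩
    apply D.ne_zero_of_mem h
    rw [← D.sum_coef α]
    refine Finset.sum_eq_zero fun γ hγ => ?_
    have h1 := congrArg (D.coef γ) hc
    rw [map_neg, D.coef_sum (fun δ => (c δ : ℝ)) hγ] at h1
    have h2 : D.coef γ α = 0 := by
      have := h0 γ hγ
      have : (0 : ℝ) ≤ c γ := by positivity
      linarith
    rw [h2, zero_smul]

lemma mem_Pos_or_mem_Neg {α : V} (h : α ∈ D.Φ) : α ∈ D.Pos ∨ α ∈ D.Neg :=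
  (D.Δ_base α h).imp (fun hc => ⟨h, hc⟩) fun hc => ⟨D.neg_mem h, hc⟩

lemma not_mem_Neg {α : V} (h : α ∈ D.Pos) : α ∉ D.Neg := by
  intro h'
  rw [mem_Pos_iff] at h
  apply D.ne_zero_of_mem h.1
  rw [← D.sum_coef α]
  refine Finset.sum_eq_zero fun γ hγ => ?_
  have h1 := (D.mem_Pos_iff.mp h').2 γ hγ
  rw [map_neg] at h1
  rw [le_antisymm (by linarith) (h.2 γ hγ), zero_smul]

lemma simple_mem_Pos {γ : V} (hγ : γ ∈ D.Δ) : γ ∈ D.Pos := by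
  rw [mem_Pos_iff]
  refine ⟨D.Δ_sub hγ, fun δ hδ => ?_⟩
  rw [D.coef_simple hδ hγ]
  split_ifs <;> simp

/-! ### Reflections -/

lemma sref_self {γ : V} (hγ : γ ∈ D.Φ) : sref V γ γ = -γ := by
  rw [sref_apply, mul_div_cancel_right₀ _ (D.inner_self_pos hγ).ne', two_smul,
    sub_add_cancel_left]

lemma coef_sref_of_ne {γ δ : V} (hγ : γ ∈ D.Δ) (hδ : δ ∈ D.Δ) (h : δ ≠ γ) (x : V) :
    D.coef δ (sref V γ x) = D.coef δ x := by
  simp [sref_apply, D.coef_simple hδ hγ, h.symm]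

/-- A simple reflection permutes the positive roots other than its own. -/
lemma sref_mem_Pos {γ β : V} (hγ : γ ∈ D.Δ) (hβ : β ∈ D.Pos) (hne : β ≠ γ) :
    sref V γ β ∈ D.Pos := by
  have hβ' := D.mem_Pos_iff.mp hβ
  refine (D.mem_Pos_or_mem_Neg (D.reflClosed γ (D.Δ_sub hγ) β hβ.1)).resolve_right fun hn => ?_
  have h0 : ∀ δ ∈ D.Δ, δ ≠ γ → D.coef δ β = 0 := by
    intro δ hδ hδγ
    have h1 := (D.mem_Pos_iff.mp hn).2 δ hδ
    rw [map_neg, D.coef_sref_of_ne hγ hδ hδγ] at h1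
    exact le_antisymm (by linarith) (hβ'.2 δ hδ)
  have h1 : β = D.coef γ β • γ := by
    conv_lhs => rw [← D.sum_coef β]
    refine Finset.sum_eq_single γ (fun δ hδ hδγ => ?_) fun h => absurd hγ h
    rw [h0 δ hδ hδγ, zero_smul]
  rcases D.reduced γ (D.Δ_sub hγ) (D.coef γ β) (h1 ▸ hβ.1) with h | h
  · rw [h, one_smul] at h1
    exact hne h1
  · have := hβ'.2 γ hγ
    linarith

end RSD

lemma sref_mul_self (α : V) : sref V α * sref V α = 1 :=
  LinearEquiv.ext (reflMap_involutive V α)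

lemma sref_inv (α : V) : (sref V α)⁻¹ = sref V α :=
  inv_eq_of_mul_eq_one_left (sref_mul_self α)

lemma sref_neg (α : V) : sref V (-α) = sref V α := by
  ext x
  simp [sref_apply, neg_div]

lemma inner_sref_sref (α x y : V) : ⟪sref V α x, sref V α y⟫ = ⟪x, y⟫ := by
  by_cases h : α = 0
  · simp [sref_apply, h]
  have h' : (⟪α, α⟫ : ℝ) ≠ 0 := inner_self_ne_zero.mpr h
  simp only [sref_apply, inner_sub_left, inner_sub_right, real_inner_smul_left,
    real_inner_smul_right, real_inner_comm y α]
  field_simp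
  ring

lemma sref_conj {w : V ≃ₗ[ℝ] V} (hw : ∀ x y, ⟪w x, w y⟫ = ⟪x, y⟫) (β : V) :
    sref V (w β) = w * sref V β * w⁻¹ := by
  ext x
  obtain ⟨y, rfl⟩ := w.surjective x
  have h : w⁻¹ (w y) = y := w.symm_apply_apply y
  simp only [LinearEquiv.mul_apply, h, sref_apply, hw, map_sub, map_smul]

namespace RSD

variable (D : RSD V)

/-! ### The Weyl group and its length function -/

lemma sref_mem_W {γ : V} (hγ : γ ∈ D.Δ) : sref V γ ∈ D.W :=
  Subgroup.subset_closure ⟨γ, hγ, rfl⟩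

lemma prod_mem_W {l : List V} (hl : ∀ γ ∈ l, γ ∈ D.Δ) : (l.map (sref V)).prod ∈ D.W := by
  refine Subgroup.list_prod_mem _ fun x hx => ?_
  obtain ⟨γ, hγ, rfl⟩ := List.mem_map.mp hx
  exact D.sref_mem_W (hl γ hγ)

lemma exists_word {w : V ≃ₗ[ℝ] V} (hw : w ∈ D.W) :
    ∃ l : List V, (∀ γ ∈ l, γ ∈ D.Δ) ∧ w = (l.map (sref V)).prod := by
  induction hw using Subgroup.closure_induction with
  | mem x hx =>
    obtain ⟨γ, hγ, rfl⟩ := hx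
    exact ⟨[γ], by simpa using hγ, by simp⟩
  | one => exact ⟨[], by simp, by simp⟩
  | mul x y _ _ hx hy =>
    obtain ⟨l, hl, rfl⟩ := hx
    obtain ⟨m, hm, rfl⟩ := hy
    refine ⟨l ++ m, fun γ hγ => ?_, by simp⟩
    exact (List.mem_append.mp hγ).elim (hl γ) (hm γ)
  | inv x _ hx =>
    obtain ⟨l, hl, rfl⟩ := hx
    refine ⟨l.reverse, fun γ hγ => hl γ (List.mem_reverse.mp hγ), ?_⟩
    rw [List.prod_inv_reverse, List.map_map, List.map_reverse]
    congr 3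

lemma W_induction {p : (V ≃ₗ[ℝ] V) → Prop} (one : p 1)
    (mul : ∀ γ ∈ D.Δ, ∀ w ∈ D.W, p w → p (sref V γ * w)) {w : V ≃ₗ[ℝ] V} (hw : w ∈ D.W) :
    p w := by
  obtain ⟨l, hl, rfl⟩ := D.exists_word hw
  clear hw
  induction l with
  | nil => exact one
  | cons γ l ih =>
    have hl' : ∀ δ ∈ l, δ ∈ D.Δ := fun δ hδ => hl δ (List.mem_cons_of_mem _ hδ)
    simpa using mul γ (hl γ List.mem_cons_self) _ (D.prod_mem_W hl') (ih hl')

lemma inner_W {w : V ≃ₗ[ℝ] V} (hw : w ∈ D.W) : ∀ x y, ⟪w x, w y⟫ = ⟪x, y⟫ := by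
  refine D.W_induction (p := fun w => ∀ x y, ⟪w x, w y⟫ = ⟪x, y⟫) (by simp) ?_ hw
  intro γ _ w _ ih x y
  rw [LinearEquiv.mul_apply, LinearEquiv.mul_apply, inner_sref_sref, ih]

lemma inner_W_left {w : V ≃ₗ[ℝ] V} (hw : w ∈ D.W) (x y : V) : ⟪w x, y⟫ = ⟪x, w⁻¹ y⟫ := by
  rw [← D.inner_W hw x (w⁻¹ y)]
  exact congrArg _ (w.apply_symm_apply y).symm

lemma W_mem_Φ {w : V ≃ₗ[ℝ] V} (hw : w ∈ D.W) : ∀ α ∈ D.Φ, w α ∈ D.Φ := by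
  refine D.W_induction (p := fun w => ∀ α ∈ D.Φ, w α ∈ D.Φ) (by simp) ?_ hw
  intro γ hγ w _ ih α hα
  exact D.reflClosed γ (D.Δ_sub hγ) _ (ih α hα)

lemma W_mem_Pos_or_Neg {w : V ≃ₗ[ℝ] V} (hw : w ∈ D.W) {α : V} (hα : α ∈ D.Φ) :
    w α ∈ D.Pos ∨ w α ∈ D.Neg :=
  D.mem_Pos_or_mem_Neg (D.W_mem_Φ hw α hα)

lemma sref_root_mem_W {β : V} (hβ : β ∈ D.Φ) : sref V β ∈ D.W := by
  suffices h : ∀ β ∈ D.Pos, sref V β ∈ D.W by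
    rcases D.mem_Pos_or_mem_Neg hβ with h' | h'
    · exact h β h'
    · rw [← sref_neg]
      exact h _ h'
  by_contra! hex
  obtain ⟨β₀, hβ₀, hW₀⟩ := hex
  let S : Finset V := D.Φ.filter fun β => β ∈ D.Pos ∧ sref V β ∉ D.W
  obtain ⟨β, hβS, hmin⟩ := S.exists_min_image (fun β => ∑ γ ∈ D.Δ, D.coef γ β)
    ⟨β₀, Finset.mem_filter.mpr ⟨hβ₀.1, hβ₀, hW₀⟩⟩
  obtain ⟨-, hβ, hW⟩ := Finset.mem_filter.mp hβS
  have hsum : 0 < ∑ γ ∈ D.Δ, D.coef γ β * ⟪β, γ⟫ := by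
    have h1 := D.inner_self_pos hβ.1
    conv at h1 => rhs; rw [← D.sum_coef β]
    rw [sum_inner] at h1
    convert! h1 using 2 with γ
    rw [D.sum_coef, real_inner_smul_left, real_inner_comm]
  obtain ⟨γ, hγ, hpos⟩ := Finset.exists_lt_of_sum_lt (f := fun _ => (0 : ℝ))
    (Finset.sum_const_zero.trans_lt hsum)
  have hip : 0 < ⟪β, γ⟫ := pos_of_mul_pos_right hpos ((D.mem_Pos_iff.mp hβ).2 γ hγ)
  have hne : β ≠ γ := fun h => hW (h ▸ D.sref_mem_W hγ)
  have hβ' := D.sref_mem_Pos hγ hβ hne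
  have hW' : sref V (sref V γ β) ∉ D.W := by
    rw [sref_conj (inner_sref_sref γ)]
    intro h
    apply hW
    have hs := D.sref_mem_W hγ
    simpa [mul_assoc] using D.W.mul_mem (D.W.mul_mem (D.W.inv_mem hs) h) hs
  have hle := hmin _ (Finset.mem_filter.mpr ⟨hβ'.1, hβ', hW'⟩)
  have hheight : ∑ δ ∈ D.Δ, D.coef δ γ = 1 := by
    rw [Finset.sum_eq_single γ]
    · simp [D.coef_simple hγ hγ]
    · intro δ hδ hδγ
      simp [D.coef_simple hδ hγ, hδγ.symm]
    · exact fun h => absurd hγ h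
  simp only [sref_apply, map_sub, map_smul, smul_eq_mul, Finset.sum_sub_distrib,
    ← Finset.mul_sum, hheight] at hle
  have : 0 < 2 * ⟪β, γ⟫ / ⟪γ, γ⟫ := div_pos (by linarith) (D.inner_self_pos (D.Δ_sub hγ))
  linarith

lemma length_prod_le {l : List V} (hl : ∀ γ ∈ l, γ ∈ D.Δ) :
    D.length (l.map (sref V)).prod ≤ l.length :=
  Nat.sInf_le ⟨l, rfl, hl, rfl⟩

lemma exists_reduced_word {w : V ≃ₗ[ℝ] V} (hw : w ∈ D.W) :
    ∃ l : List V, l.length = D.length w ∧ (∀ γ ∈ l, γ ∈ D.Δ) ∧ w = (l.map (sref V)).prod := by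
  obtain ⟨l, hl, h⟩ := D.exists_word hw
  exact Nat.sInf_mem (s := {n | ∃ l : List V, l.length = n ∧ (∀ γ ∈ l, γ ∈ D.Δ) ∧
    w = (l.map (sref V)).prod}) ⟨_, l, rfl, hl, h⟩

/-- The strong exchange condition. -/
lemma exchange (l : List V) (hl : ∀ γ ∈ l, γ ∈ D.Δ) {β : V} (hβ : β ∈ D.Pos)
    (hneg : (l.map (sref V)).prod⁻¹ β ∈ D.Neg) :
    ∃ l' : List V, (∀ γ ∈ l', γ ∈ D.Δ) ∧ l'.length + 1 = l.length ∧
      sref V β * (l.map (sref V)).prod = (l'.map (sref V)).prod := by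
  induction l generalizing β with
  | nil => exact absurd hneg (by simpa using D.not_mem_Neg hβ)
  | cons γ l ih =>
    have hγ : γ ∈ D.Δ := hl γ List.mem_cons_self
    have hl' : ∀ δ ∈ l, δ ∈ D.Δ := fun δ hδ => hl δ (List.mem_cons_of_mem _ hδ)
    by_cases h : β = γ
    · subst h
      refine ⟨l, hl', rfl, ?_⟩
      rw [List.map_cons, List.prod_cons, ← mul_assoc, sref_mul_self, one_mul]
    · rw [List.map_cons, List.prod_cons, mul_inv_rev, sref_inv, LinearEquiv.mul_apply] at hneg
      obtain ⟨m, hm, hlen, hprod⟩ := ih hl' (D.sref_mem_Pos hγ hβ h) hneg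
      refine ⟨γ :: m, ?_, by simpa using hlen, ?_⟩
      · intro δ hδ
        rcases List.mem_cons.mp hδ with rfl | hδ
        · exact hγ
        · exact hm δ hδ
      · rw [List.map_cons, List.prod_cons, List.map_cons, List.prod_cons, ← hprod,
          sref_conj (inner_sref_sref γ), sref_inv]
        simp only [← mul_assoc, sref_mul_self, one_mul]

lemma length_sref_mul_lt {x : V ≃ₗ[ℝ] V} (hx : x ∈ D.W) {β : V} (hβ : β ∈ D.Pos)
    (hneg : x⁻¹ β ∈ D.Neg) : D.length (sref V β * x) < D.length x := by
  obtain ⟨l, hlen, hl, rfl⟩ := D.exists_reduced_word hx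
  obtain ⟨m, hm, hlen', hprod⟩ := D.exchange l hl hβ hneg
  rw [hprod]
  have := D.length_prod_le hm
  omega

lemma length_lt_sref_mul {x : V ≃ₗ[ℝ] V} (hx : x ∈ D.W) {β : V} (hβ : β ∈ D.Pos)
    (hpos : x⁻¹ β ∈ D.Pos) : D.length x < D.length (sref V β * x) := by
  have h := D.length_sref_mul_lt (D.W.mul_mem (D.sref_root_mem_W hβ.1) hx) hβ (by
    rw [mul_inv_rev, sref_inv, LinearEquiv.mul_apply, D.sref_self hβ.1, map_neg]
    simpa [Neg] using hpos)
  rwa [← mul_assoc, sref_mul_self, one_mul] at h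

lemma exists_simple_inv_mem_Neg {w : V ≃ₗ[ℝ] V} (hw : w ∈ D.W) (h1 : w ≠ 1) :
    ∃ γ ∈ D.Δ, w⁻¹ γ ∈ D.Neg := by
  obtain ⟨l, hlen, hl, hprod⟩ := D.exists_reduced_word hw
  cases l with
  | nil => exact absurd hprod h1
  | cons γ l =>
    have hγ : γ ∈ D.Δ := hl γ List.mem_cons_self
    refine ⟨γ, hγ, (D.W_mem_Pos_or_Neg (D.W.inv_mem hw) (D.Δ_sub hγ)).resolve_left fun hp => ?_⟩
    have h2 := D.length_lt_sref_mul hw (D.simple_mem_Pos hγ) hp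
    have h3 : sref V γ * w = (l.map (sref V)).prod := by
      rw [hprod, List.map_cons, List.prod_cons, ← mul_assoc, sref_mul_self, one_mul]
    have h4 := D.length_prod_le (l := l) fun δ hδ => hl δ (List.mem_cons_of_mem _ hδ)
    rw [h3] at h2
    rw [List.length_cons] at hlen
    omega

lemma exists_simple_mem_Neg {w : V ≃ₗ[ℝ] V} (hw : w ∈ D.W) (h1 : w ≠ 1) :
    ∃ γ ∈ D.Δ, w γ ∈ D.Neg := by
  simpa using D.exists_simple_inv_mem_Neg (D.W.inv_mem hw) (inv_ne_one.mpr h1)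

/-! ### Dominance and the Bruhat order -/

lemma coef_sub_nonneg_of_ble {u v : V ≃ₗ[ℝ] V} (hu : u ∈ D.W) (h : D.ble u v) {lam : V}
    (hlam : ∀ α ∈ D.Pos, 0 ≤ ⟪lam, α⟫) :
    v ∈ D.W ∧ ∀ γ ∈ D.Δ, 0 ≤ D.coef γ (u lam - v lam) := by
  induction h with
  | refl => exact ⟨hu, by simp⟩
  | @tail x y _ hxy ih =>
    obtain ⟨hx, ih⟩ := ih
    obtain ⟨⟨β, hβ, rfl⟩, hlen⟩ := hxy
    refine ⟨D.W.mul_mem (D.sref_root_mem_W hβ) hx, fun γ hγ => ?_⟩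
    wlog hp : β ∈ D.Pos generalizing β
    · have := this (-β) (D.neg_mem hβ) (by rwa [sref_neg])
        ((D.mem_Pos_or_mem_Neg hβ).resolve_left hp)
      rwa [sref_neg] at this
    have hxp : x⁻¹ β ∈ D.Pos :=
      (D.W_mem_Pos_or_Neg (D.W.inv_mem hx) hβ).resolve_right fun hn =>
        absurd (D.length_sref_mul_lt hx hp hn) hlen.not_gt
    have h1 := ih γ hγ
    have h2 : 0 ≤ 2 * ⟪x lam, β⟫ / ⟪β, β⟫ * D.coef γ β := by
      have h3 := hlam _ hxp
      rw [← D.inner_W_left hx] at h3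
      have h4 := D.inner_self_pos hβ
      have h5 := (D.mem_Pos_iff.mp hp).2 γ hγ
      positivity
    simp only [LinearEquiv.mul_apply, sref_apply, map_sub, map_smul, smul_eq_mul] at h1 ⊢
    linarith

/-- An element of the Weyl group moves `lam` by an element of a lattice `Q` that is stable under
the simple reflections, as soon as the simple reflections do so. -/
lemma sub_W_mem (Q : AddSubgroup V) {lam : V} (hQ : ∀ γ ∈ D.Δ, ∀ q ∈ Q, sref V γ q ∈ Q)
    (hlam : ∀ γ ∈ D.Δ, lam - sref V γ lam ∈ Q) {w : V ≃ₗ[ℝ] V} (hw : w ∈ D.W) :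
    lam - w lam ∈ Q := by
  refine D.W_induction (p := fun w => lam - w lam ∈ Q) (by simp) ?_ hw
  intro γ hγ w _ ih
  have h := Q.add_mem (hlam γ hγ) (hQ γ hγ _ ih)
  rw [map_sub] at h
  simpa [LinearEquiv.mul_apply] using h

/-- The lattice generated by the multiples `k γ • γ` of the simple roots. -/
def lattice (k : V → ℝ) : AddSubgroup V := AddSubgroup.closure ((fun γ => k γ • γ) '' ↑D.Δ)

lemma exists_int_of_mem_lattice {k : V → ℝ} {x : V} (hx : x ∈ D.lattice k) {γ : V}
    (hγ : γ ∈ D.Δ) : ∃ n : ℤ, D.coef γ x = n * k γ := by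
  induction hx using AddSubgroup.closure_induction with
  | mem x hx =>
    obtain ⟨δ, hδ, rfl⟩ := hx
    by_cases h : δ = γ
    · subst h
      exact ⟨1, by simp [D.coef_simple hγ hγ]⟩
    · exact ⟨0, by simp [D.coef_simple hγ hδ, h]⟩
  | zero => exact ⟨0, by simp⟩
  | add x y _ _ hx hy =>
    obtain ⟨m, hm⟩ := hx
    obtain ⟨n, hn⟩ := hy
    exact ⟨m + n, by rw [map_add, hm, hn]; push_cast; ring⟩
  | neg x _ hx =>
    obtain ⟨m, hm⟩ := hx
    exact ⟨-m, by rw [map_neg, hm]; push_cast; ring⟩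

/-- Differences in a Weyl group orbit have nonnegative coordinates exactly when they are
nonnegative integer combinations of the generators of a suitable lattice. -/
lemma exists_nat_sum_iff (k : V → ℝ) (hk : ∀ γ ∈ D.Δ, 0 < k γ) {lam : V}
    (hQ : ∀ γ ∈ D.Δ, ∀ δ ∈ D.Δ, ∃ n : ℤ, 2 * ⟪k δ • δ, γ⟫ / ⟪γ, γ⟫ = n * k γ)
    (hlam : ∀ γ ∈ D.Δ, ∃ n : ℤ, 2 * ⟪lam, γ⟫ / ⟪γ, γ⟫ = n * k γ)
    {u v : V ≃ₗ[ℝ] V} (hu : u ∈ D.W) (hv : v ∈ D.W) :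
    (∃ c : V → ℕ, u lam - v lam = ∑ γ ∈ D.Δ, (c γ : ℝ) • k γ • γ) ↔
      ∀ γ ∈ D.Δ, 0 ≤ D.coef γ (u lam - v lam) := by
  have hgen : ∀ γ ∈ D.Δ, ∀ n : ℤ, (n * k γ) • γ ∈ D.lattice k := fun γ hγ n => by
    rw [mul_smul, Int.cast_smul_eq_zsmul]
    have h : k γ • γ ∈ D.lattice k := AddSubgroup.subset_closure ⟨γ, hγ, rfl⟩
    exact zsmul_mem h n
  have hstable : ∀ γ ∈ D.Δ, ∀ q ∈ D.lattice k, sref V γ q ∈ D.lattice k := by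
    intro γ hγ q hq
    induction hq using AddSubgroup.closure_induction with
    | mem x hx =>
      obtain ⟨δ, hδ, rfl⟩ := hx
      obtain ⟨n, hn⟩ := hQ γ hγ δ hδ
      simp only [sref_apply, hn]
      exact sub_mem (AddSubgroup.subset_closure ⟨δ, hδ, rfl⟩) (hgen γ hγ n)
    | zero => simp
    | add x y _ _ hx hy => rw [map_add]; exact add_mem hx hy
    | neg x _ hx => rw [map_neg]; exact NegMemClass.neg_mem hx
  have hmove : ∀ γ ∈ D.Δ, lam - sref V γ lam ∈ D.lattice k := by
    intro γ hγ
    obtain ⟨n, hn⟩ := hlam γ hγ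
    rw [sref_apply, sub_sub_cancel, hn]
    exact hgen γ hγ n
  have hmem : u lam - v lam ∈ D.lattice k := by
    have := sub_mem (D.sub_W_mem _ hstable hmove hv) (D.sub_W_mem _ hstable hmove hu)
    rwa [sub_sub_sub_cancel_left] at this
  constructor
  · rintro ⟨c, hc⟩ γ hγ
    rw [hc]
    simp only [← mul_smul]
    rw [D.coef_sum (fun γ => (c γ : ℝ) * k γ) hγ]
    have := hk γ hγ
    positivity
  · intro h0
    have hc : ∀ γ ∈ D.Δ, ∃ n : ℕ, D.coef γ (u lam - v lam) = n * k γ := by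
      intro γ hγ
      obtain ⟨n, hn⟩ := D.exists_int_of_mem_lattice hmem hγ
      have h1 := h0 γ hγ
      rw [hn] at h1
      have h2 : 0 ≤ n := by exact_mod_cast nonneg_of_mul_nonneg_left h1 (hk γ hγ)
      lift n to ℕ using h2
      exact ⟨n, by simpa using hn⟩
    choose! c hc using hc
    refine ⟨c, ?_⟩
    conv_lhs => rw [← D.sum_coef (u lam - v lam)]
    exact Finset.sum_congr rfl fun γ hγ => by rw [hc γ hγ, mul_smul]

end RSD

namespace MRSD

variable (M : MRSD V)

/-! ### Inversion sets -/

lemma InvSet_sref_mul {u : V ≃ₗ[ℝ] V} {γ : V} (hγ : γ ∈ M.Δ) (hu : u ∈ M.W)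
    (hp : u⁻¹ γ ∈ M.Pos) : M.InvSet (sref V γ * u) = insert (u⁻¹ γ) (M.InvSet u) := by
  have huγ : u (u⁻¹ γ) = γ := u.apply_symm_apply γ
  ext α
  simp only [InvSet, Set.mem_insert_iff, Set.mem_ofPred_eq, LinearEquiv.mul_apply]
  constructor
  · rintro ⟨hα, hn⟩
    by_cases h : u α = γ
    · exact Or.inl (u.injective (h.trans huγ.symm))
    · exact Or.inr ⟨hα, (M.W_mem_Pos_or_Neg hu hα.1).resolve_left fun hp' =>
        M.not_mem_Neg (M.sref_mem_Pos hγ hp' h) hn⟩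
  · rintro (rfl | ⟨hα, hn⟩)
    · refine ⟨hp, ?_⟩
      rw [huγ, M.sref_self (M.Δ_sub hγ)]
      simpa [RSD.Neg] using M.simple_mem_Pos hγ
    · refine ⟨hα, ?_⟩
      have hne : -u α ≠ γ := by
        intro h
        have h1 : α = -u⁻¹ γ := by
          rw [← h, map_neg, neg_neg]
          exact (u.symm_apply_apply α).symm
        refine M.not_mem_Neg hα ?_
        rw [h1]
        simpa [RSD.Neg] using hp
      have h2 := M.sref_mem_Pos hγ hn hne
      rwa [map_neg] at h2

lemma InvSet_finite (u : V ≃ₗ[ℝ] V) : (M.InvSet u).Finite :=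
  M.Φ.finite_toSet.subset fun _ h => h.1.1

lemma ble_of_InvSet_subset {u v : V ≃ₗ[ℝ] V} (hu : u ∈ M.W) (hv : v ∈ M.W)
    (h : M.InvSet u ⊆ M.InvSet v) : M.ble u v := by
  induction hn : (M.InvSet v \ M.InvSet u).ncard using Nat.strong_induction_on generalizing u with
  | _ n ih =>
    by_cases h1 : v * u⁻¹ = 1
    · rw [mul_inv_eq_one] at h1
      exact h1 ▸ Relation.ReflTransGen.refl
    obtain ⟨γ, hγ, hneg⟩ := M.exists_simple_mem_Neg (M.W.mul_mem hv (M.W.inv_mem hu)) h1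
    rw [LinearEquiv.mul_apply] at hneg
    have huγ : u (u⁻¹ γ) = γ := u.apply_symm_apply γ
    have hp : u⁻¹ γ ∈ M.Pos := by
      refine (M.W_mem_Pos_or_Neg (M.W.inv_mem hu) (M.Δ_sub hγ)).resolve_right fun hn' => ?_
      have h2 : -u⁻¹ γ ∈ M.InvSet u := by
        refine ⟨hn', ?_⟩
        rw [map_neg, huγ]
        simpa [RSD.Neg] using M.simple_mem_Pos hγ
      have h3 := (h h2).2
      rw [map_neg] at h3
      exact M.not_mem_Neg (by simpa [RSD.Neg] using h3) hneg
    have hnot : u⁻¹ γ ∉ M.InvSet u := fun h2 =>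
      M.not_mem_Neg (M.simple_mem_Pos hγ) (huγ ▸ h2.2)
    have hin : u⁻¹ γ ∈ M.InvSet v := ⟨hp, hneg⟩
    have hins := M.InvSet_sref_mul hγ hu hp
    refine Relation.ReflTransGen.head ⟨⟨γ, M.Δ_sub hγ, rfl⟩,
      M.length_lt_sref_mul hu (M.simple_mem_Pos hγ) hp⟩
      (ih _ ?_ (M.W.mul_mem (M.sref_mem_W hγ) hu) ?_ rfl)
    · rw [← hn, hins]
      refine Set.ncard_lt_ncard ⟨Set.sdiff_subset_sdiff_right (Set.subset_insert _ _), fun hs => ?_⟩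
        ((M.InvSet_finite v).sdiff)
      exact (hs ⟨hin, hnot⟩).2 (Set.mem_insert _ _)
    · rw [hins]
      exact Set.insert_subset hin h

/-! ### Minimal coset representatives and the cominuscule coweight -/

lemma IsMinRep.simple_mem_Pos {u : V ≃ₗ[ℝ] V} (hu : M.IsMinRep u) {α : V} (hα : α ∈ M.Δ)
    (hne : α ≠ M.αP) : u α ∈ M.Pos := by
  refine (M.W_mem_Pos_or_Neg hu.1 (M.Δ_sub hα)).resolve_right fun hn => ?_
  have hprod : sref V (-u α) * u = u * sref V α := by
    rw [sref_neg, sref_conj (M.inner_W hu.1), inv_mul_cancel_right]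
  have h1 := M.length_sref_mul_lt hu.1 hn (by
    rw [map_neg, show u⁻¹ (u α) = α from u.symm_apply_apply α]
    simpa [RSD.Neg] using M.simple_mem_Pos hα)
  rw [hprod] at h1
  refine absurd (hu.2 (u * sref V α) (M.W.mul_mem hu.1 (M.sref_mem_W hα)) ?_) h1.not_ge
  rw [inv_mul_cancel_left]
  exact Subgroup.subset_closure ⟨α, Finset.mem_coe.mpr (Finset.mem_erase.mpr ⟨hne, hα⟩), rfl⟩

variable {M} {ωc : V}

lemma inner_coweight (hωc : ∀ γ ∈ M.Δ, ⟪ωc, γ⟫ = if γ = M.αP then (1 : ℝ) else 0) (x : V) :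
    ⟪ωc, x⟫ = M.coef M.αP x := by
  conv_lhs => rw [← M.sum_coef x]
  rw [inner_sum, Finset.sum_eq_single M.αP]
  · rw [real_inner_smul_right, hωc _ M.αP_mem, if_pos rfl, mul_one]
  · intro γ hγ hne
    rw [real_inner_smul_right, hωc _ hγ, if_neg hne, mul_zero]
  · exact fun h => absurd M.αP_mem h

lemma coef_αP_of_mem_Pos {α : V} (hα : α ∈ M.Pos) :
    M.coef M.αP α = 0 ∨ M.coef M.αP α = 1 := by
  obtain ⟨hΦ, c, hc⟩ := hα
  obtain ⟨d, hd⟩ := M.θ_high α hΦ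
  obtain ⟨e, he, he1⟩ := M.θ_coeff
  have h1 : M.coef M.αP α = c M.αP := by rw [hc]; exact M.coef_sum (fun γ => (c γ : ℝ)) M.αP_mem
  have h2 : M.coef M.αP M.θ = 1 := by
    rw [he, M.coef_sum (fun γ => (e γ : ℝ)) M.αP_mem, he1, Nat.cast_one]
  have h3 := congrArg (M.coef M.αP) hd
  rw [map_sub, h1, h2, M.coef_sum (fun γ => (d γ : ℝ)) M.αP_mem] at h3
  have h4 : c M.αP + d M.αP = 1 := by
    have : (c M.αP : ℝ) + d M.αP = 1 := by linarith
    exact_mod_cast this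
  rw [h1]
  have : c M.αP = 0 ∨ c M.αP = 1 := by omega
  exact_mod_cast this

lemma coef_αP_of_mem {α : V} (hα : α ∈ M.Φ) :
    M.coef M.αP α = -1 ∨ M.coef M.αP α = 0 ∨ M.coef M.αP α = 1 := by
  rcases M.mem_Pos_or_mem_Neg hα with h | h
  · exact Or.inr (coef_αP_of_mem_Pos h)
  · have := coef_αP_of_mem_Pos h
    rw [map_neg] at this
    grind

lemma mem_Pos_of_coef_pos {α : V} (hα : α ∈ M.Φ) (h : 0 < M.coef M.αP α) : α ∈ M.Pos := by
  refine (M.mem_Pos_or_mem_Neg hα).resolve_right fun hn => ?_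
  have := (M.mem_Pos_iff.mp hn).2 _ M.αP_mem
  rw [map_neg] at this
  linarith

variable (M) in
/-- `u` lies in the Weyl group and sends the positive roots of `Φ_P` to positive roots. -/
def PosOnLevi (u : V ≃ₗ[ℝ] V) : Prop :=
  u ∈ M.W ∧ ∀ α ∈ M.Pos, M.coef M.αP α = 0 → u α ∈ M.Pos

lemma IsMinRep.posOnLevi {u : V ≃ₗ[ℝ] V} (hu : M.IsMinRep u) : M.PosOnLevi u := by
  refine ⟨hu.1, fun α hα h0 => M.mem_Pos_iff.mpr ⟨M.W_mem_Φ hu.1 α hα.1, fun γ hγ => ?_⟩⟩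
  rw [← M.sum_coef α, map_sum, map_sum]
  refine Finset.sum_nonneg fun δ hδ => ?_
  rw [map_smul, map_smul, smul_eq_mul]
  by_cases h : δ = M.αP
  · rw [h, h0, zero_mul]
  · exact mul_nonneg ((M.mem_Pos_iff.mp hα).2 δ hδ)
      ((M.mem_Pos_iff.mp (IsMinRep.simple_mem_Pos M hu hδ h)).2 γ hγ)

lemma PosOnLevi.sref_mul {u : V ≃ₗ[ℝ] V} (hu : M.PosOnLevi u) {γ : V} (hγ : γ ∈ M.Δ)
    (h : M.coef M.αP (u⁻¹ γ) ≠ 0) : M.PosOnLevi (sref V γ * u) := by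
  refine ⟨M.W.mul_mem (M.sref_mem_W hγ) hu.1, fun α hα h0 => ?_⟩
  refine M.sref_mem_Pos hγ (hu.2 α hα h0) fun he => h ?_
  rw [← he, ← h0]
  exact congrArg _ (u.symm_apply_apply α)

lemma PosOnLevi.eq_of_apply_eq (hωc : ∀ γ ∈ M.Δ, ⟪ωc, γ⟫ = if γ = M.αP then (1 : ℝ) else 0)
    {u v : V ≃ₗ[ℝ] V} (hu : M.PosOnLevi u) (hv : M.PosOnLevi v) (h : u ωc = v ωc) : u = v := by
  by_contra hne
  have hx : v⁻¹ * u ∈ M.W := M.W.mul_mem (M.W.inv_mem hv.1) hu.1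
  obtain ⟨γ, hγ, hneg⟩ := M.exists_simple_mem_Neg hx fun h1 => hne (inv_mul_eq_one.mp h1).symm
  have hfix : (v⁻¹ * u) ωc = ωc := by
    rw [LinearEquiv.mul_apply, h]
    exact v.symm_apply_apply ωc
  have hcoef : M.coef M.αP ((v⁻¹ * u) γ) = M.coef M.αP γ := by
    rw [← inner_coweight hωc, ← inner_coweight hωc]
    conv_lhs => rw [← hfix]
    exact M.inner_W hx _ _
  rcases coef_αP_of_mem_Pos (M.simple_mem_Pos hγ) with h0 | h1
  · have h2 := hv.2 _ hneg (by rw [map_neg, hcoef, h0, neg_zero])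
    rw [map_neg, LinearEquiv.mul_apply, show v (v⁻¹ (u γ)) = u γ from v.apply_symm_apply _] at h2
    exact M.not_mem_Neg (hu.2 γ (M.simple_mem_Pos hγ) h0) h2
  · exact M.not_mem_Neg (mem_Pos_of_coef_pos (M.W_mem_Φ hx γ (M.Δ_sub hγ))
      (by rw [hcoef, h1]; exact one_pos)) hneg

lemma sref_mul_apply_coweight (hωc : ∀ γ ∈ M.Δ, ⟪ωc, γ⟫ = if γ = M.αP then (1 : ℝ) else 0)
    {u : V ≃ₗ[ℝ] V} (hu : u ∈ M.W) (γ : V) :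
    (sref V γ * u) ωc = u ωc - M.coef M.αP (u⁻¹ γ) • coroot γ := by
  rw [LinearEquiv.mul_apply, sref_apply, M.inner_W_left hu, inner_coweight hωc, coroot, smul_smul]
  congr 2
  ring

lemma exists_sum_update {S : Finset V} {γ : V} (hγ : γ ∈ S) (f : V → V) {c : V → ℕ}
    (hc : 0 < c γ) : ∃ d : V → ℕ, ∑ δ ∈ S, d δ < ∑ δ ∈ S, c δ ∧
      ∑ δ ∈ S, (c δ : ℝ) • f δ - f γ = ∑ δ ∈ S, (d δ : ℝ) • f δ := by
  obtain ⟨n, hn⟩ : ∃ n, c γ = n + 1 := ⟨c γ - 1, by omega⟩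
  refine ⟨Function.update c γ n, ?_, ?_⟩
  · refine Finset.sum_lt_sum (fun δ _ => ?_) ⟨γ, hγ, by simp [hn]⟩
    by_cases h : δ = γ
    · subst h; simp [hn]
    · simp [h]
  · have hrest : ∑ δ ∈ S.erase γ, (Function.update c γ n δ : ℝ) • f δ =
        ∑ δ ∈ S.erase γ, (c δ : ℝ) • f δ := Finset.sum_congr rfl fun δ hδ => by
      rw [Function.update_of_ne (Finset.ne_of_mem_erase hδ)]
    rw [← Finset.add_sum_erase _ _ hγ, ← Finset.add_sum_erase S (fun δ => _ • f δ) hγ, hrest]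
    simp only [hn, Function.update_self]
    push_cast
    rw [add_smul, one_smul]
    abel

/-- Dominance in the orbit of the cominuscule coweight implies containment of inversion sets. -/
lemma PosOnLevi.InvSet_subset_of_cdom
    (hωc : ∀ γ ∈ M.Δ, ⟪ωc, γ⟫ = if γ = M.αP then (1 : ℝ) else 0)
    {u v : V ≃ₗ[ℝ] V} (hu : M.PosOnLevi u) (hv : M.PosOnLevi v)
    (h : M.cdom (v ωc) (u ωc)) : M.InvSet u ⊆ M.InvSet v := by
  obtain ⟨c, hc⟩ := h
  induction hn : ∑ γ ∈ M.Δ, c γ using Nat.strong_induction_on generalizing u v c with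
  | _ n ih =>
    by_cases heq : u ωc = v ωc
    · rw [PosOnLevi.eq_of_apply_eq hωc hu hv heq]
    have hpos : 0 < ∑ γ ∈ M.Δ, (c γ : ℝ) * (2 / ⟪γ, γ⟫) * ⟪u ωc - v ωc, γ⟫ := by
      have h1 : 0 < ⟪u ωc - v ωc, u ωc - v ωc⟫ :=
        real_inner_self_pos.mpr (sub_ne_zero.mpr heq)
      conv at h1 => rhs; arg 3; rw [hc]
      rw [inner_sum] at h1
      refine h1.trans_eq (Finset.sum_congr rfl fun γ _ => ?_)
      rw [coroot, real_inner_smul_right, real_inner_smul_right, mul_assoc]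
    obtain ⟨γ, hγ, hγpos⟩ := Finset.exists_lt_of_sum_lt (f := fun _ => (0 : ℝ))
      (Finset.sum_const_zero.trans_lt hpos)
    have hnorm := M.inner_self_pos (M.Δ_sub hγ)
    have hcγ : 0 < c γ := by
      refine Nat.pos_of_ne_zero fun h0 => ?_
      simp [h0] at hγpos
    have hlt : M.coef M.αP (v⁻¹ γ) < M.coef M.αP (u⁻¹ γ) := by
      have h1 : 0 < ⟪u ωc - v ωc, γ⟫ := pos_of_mul_pos_right hγpos (by positivity)
      rw [inner_sub_left, M.inner_W_left hu.1, M.inner_W_left hv.1, inner_coweight hωc,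
        inner_coweight hωc] at h1
      linarith
    obtain ⟨d, hdlt, hd⟩ := exists_sum_update hγ coroot hcγ
    have hΦu := M.W_mem_Φ (M.W.inv_mem hu.1) γ (M.Δ_sub hγ)
    have hΦv := M.W_mem_Φ (M.W.inv_mem hv.1) γ (M.Δ_sub hγ)
    have hcases : M.coef M.αP (u⁻¹ γ) = 1 ∨ M.coef M.αP (v⁻¹ γ) = -1 := by
      rcases coef_αP_of_mem hΦu with h1 | h1 | h1 <;>
        rcases coef_αP_of_mem hΦv with h2 | h2 | h2 <;> simp_all <;> linarith
    rcases hcases with h1 | h1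
    · have hsub := ih _ (hn ▸ hdlt) (hu.sref_mul hγ (by rw [h1]; exact one_ne_zero)) hv d
        (by rw [← hd, ← hc, sref_mul_apply_coweight hωc hu.1, h1, one_smul]; abel) rfl
      rw [M.InvSet_sref_mul hγ hu.1 (mem_Pos_of_coef_pos hΦu (by rw [h1]; exact one_pos))] at hsub
      exact (Set.subset_insert _ _).trans hsub
    · have hv' := hv.sref_mul hγ (by rw [h1]; norm_num)
      have hsub := ih _ (hn ▸ hdlt) hu hv' d
        (by rw [← hd, ← hc, sref_mul_apply_coweight hωc hv.1, h1, neg_smul, one_smul]; abel) rfl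
      have hinv : (sref V γ * v)⁻¹ γ = -v⁻¹ γ := by
        rw [mul_inv_rev, sref_inv, LinearEquiv.mul_apply, M.sref_self (M.Δ_sub hγ), map_neg]
      have hins := M.InvSet_sref_mul hγ hv'.1 (by
        rw [hinv]
        refine mem_Pos_of_coef_pos (M.neg_mem hΦv) ?_
        rw [map_neg, h1]
        norm_num)
      rw [← mul_assoc, sref_mul_self, one_mul] at hins
      rw [hins]
      exact hsub.trans (Set.subset_insert _ _)

lemma weight_eq_smul_coweight {ω : V}
    (hω : ∀ γ ∈ M.Δ, 2 * ⟪ω, γ⟫ / ⟪γ, γ⟫ = if γ = M.αP then (1 : ℝ) else 0)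
    (hωc : ∀ γ ∈ M.Δ, ⟪ωc, γ⟫ = if γ = M.αP then (1 : ℝ) else 0) :
    ω = (⟪M.αP, M.αP⟫ / 2) • ωc := by
  refine ext_inner_right ℝ fun x => ?_
  rw [← M.sum_coef x, inner_sum, inner_sum]
  refine Finset.sum_congr rfl fun γ hγ => ?_
  have hpos := M.inner_self_pos (M.Δ_sub hγ)
  have h := hω γ hγ
  rw [div_eq_iff hpos.ne'] at h
  rw [real_inner_smul_right, real_inner_smul_right, real_inner_smul_left, hωc γ hγ]
  congr 1
  split_ifs at h ⊢ with h1
  · subst h1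
    linarith
  · linarith

lemma cdom_iff (hωc : ∀ γ ∈ M.Δ, ⟪ωc, γ⟫ = if γ = M.αP then (1 : ℝ) else 0)
    {u v : V ≃ₗ[ℝ] V} (hu : u ∈ M.W) (hv : v ∈ M.W) :
    M.cdom (v ωc) (u ωc) ↔ ∀ γ ∈ M.Δ, 0 ≤ M.coef γ (u ωc - v ωc) := by
  refine M.exists_nat_sum_iff (fun γ => 2 / ⟪γ, γ⟫)
    (fun γ hγ => div_pos two_pos (M.inner_self_pos (M.Δ_sub hγ))) ?_ ?_ hu hv
  · intro γ hγ δ hδ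
    obtain ⟨n, hn⟩ := M.crystal δ (M.Δ_sub hδ) γ (M.Δ_sub hγ)
    refine ⟨n, ?_⟩
    rw [hn, real_inner_smul_left, real_inner_comm γ δ]
    ring
  · intro γ hγ
    refine ⟨if γ = M.αP then 1 else 0, ?_⟩
    rw [hωc γ hγ]
    split_ifs <;> simp

lemma dom_iff {ω : V}
    (hω : ∀ γ ∈ M.Δ, 2 * ⟪ω, γ⟫ / ⟪γ, γ⟫ = if γ = M.αP then (1 : ℝ) else 0)
    {u v : V ≃ₗ[ℝ] V} (hu : u ∈ M.W) (hv : v ∈ M.W) :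
    M.dom (v ω) (u ω) ↔ ∀ γ ∈ M.Δ, 0 ≤ M.coef γ (u ω - v ω) := by
  have h := M.exists_nat_sum_iff (fun _ => 1) (fun _ _ => one_pos) (lam := ω) ?_ ?_ hu hv
  · simp only [one_smul] at h
    exact h
  · intro γ hγ δ hδ
    obtain ⟨n, hn⟩ := M.crystal γ (M.Δ_sub hγ) δ (M.Δ_sub hδ)
    exact ⟨n, by rw [one_smul, mul_one, hn]⟩
  · intro γ hγ
    refine ⟨if γ = M.αP then 1 else 0, ?_⟩
    rw [hω γ hγ]
    split_ifs <;> simp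

end MRSD

end

/-- For `u, v ∈ W^P` the following are equivalent: (i) `u ≤ v` in the Bruhat
order; (ii) `Φ⁺(u) ⊆ Φ⁺(v)`; (iii) `v(ω_P^∨) ≤ u(ω_P^∨)` in the dominance order on
coweights; (iv) `v(ω_P) ≤ u(ω_P)` in the dominance order on weights.  Here `ωc` is the
fundamental coweight and `ω` the fundamental weight associated with `α_P`. -/
theorem statement2 {V : Type} [NormedAddCommGroup V] [InnerProductSpace ℝ V]
    [FiniteDimensional ℝ V]
    (M : MRSD V) (u v : V ≃ₗ[ℝ] V)
    (hu : M.IsMinRep u) (hv : M.IsMinRep v)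
    (ω ωc : V)
    (hω : ∀ γ ∈ M.Δ, 2 * ⟪ω, γ⟫ / ⟪γ, γ⟫ = if γ = M.αP then (1 : ℝ) else 0)
    (hωc : ∀ γ ∈ M.Δ, ⟪ωc, γ⟫ = if γ = M.αP then (1 : ℝ) else 0) :
    (M.ble u v ↔ M.InvSet u ⊆ M.InvSet v) ∧
    (M.ble u v ↔ M.cdom (v ωc) (u ωc)) ∧
    (M.ble u v ↔ M.dom (v ω) (u ω)) := by
  have hble : M.ble u v → M.cdom (v ωc) (u ωc) := fun h =>
    (MRSD.cdom_iff hωc hu.1 hv.1).mpr (M.coef_sub_nonneg_of_ble hu.1 h fun α hα => by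
      rw [MRSD.inner_coweight hωc]
      exact (M.mem_Pos_iff.mp hα).2 _ M.αP_mem).2
  have hcdom : M.cdom (v ωc) (u ωc) → M.InvSet u ⊆ M.InvSet v :=
    hu.posOnLevi.InvSet_subset_of_cdom hωc hv.posOnLevi
  have hinv : M.InvSet u ⊆ M.InvSet v → M.ble u v := M.ble_of_InvSet_subset hu.1 hv.1
  have hdom : M.cdom (v ωc) (u ωc) ↔ M.dom (v ω) (u ω) := by
    rw [MRSD.cdom_iff hωc hu.1 hv.1, MRSD.dom_iff hω hu.1 hv.1,
      MRSD.weight_eq_smul_coweight hω hωc]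
    simp only [map_smul, ← smul_sub, smul_eq_mul]
    have hk : 0 < ⟪M.αP, M.αP⟫ / 2 := half_pos (M.inner_self_pos (M.Δ_sub M.αP_mem))
    exact forall₂_congr fun γ _ => (mul_nonneg_iff_of_pos_left hk).symm
  have hc : M.ble u v ↔ M.cdom (v ωc) (u ωc) := ⟨hble, fun h => hinv (hcdom h)⟩
  exact ⟨⟨fun h => hcdom (hble h), hinv⟩, hc, hc.trans hdom⟩
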